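/- arXiv:1903.07984 — 4 statements merged into one kernel-verified Lean document; each statement's English description precedes it below -/
import Mathlib

section
/- In the quadratic algebra B defined by a linear involution R of E⊗E, the submodules X and Y satisfy X*Y = Y*X (equality of products of ℝ-submodules of B). -/
open scoped TensorProduct
open TensorAlgebra

noncomputable section

variable (E : Type*) [AddCommGroup E] [Module ℝ E]

/-- The linear map `E ⊗ E → T(E ⊕ E)` sending `u ⊗ v` to `ι(a u) * ι(b v)` for two
linear inclusions `a b : E → E ⊕ E`; e.g. `(y⊗x)(u⊗v) = y(u)⊗x(v)`. -/
def pairMul (a b : E →ₗ[ℝ] E × E) :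
    E ⊗[ℝ] E →ₗ[ℝ] TensorAlgebra ℝ (E × E) :=
  LinearMap.mul' ℝ (TensorAlgebra ℝ (E × E)) ∘ₗ
    TensorProduct.map (ι ℝ ∘ₗ a) (ι ℝ ∘ₗ b)

/-- The relations of the paper's bigraded algebra `A`: with `x, y : E → E ⊕ E` the two
canonical inclusions, `x(u)x(v) = (x⊗x)(R(u⊗v))`, `x(u)y(v) = (y⊗x)(R(u⊗v))`,
`y(u)x(v) = (x⊗y)(R(u⊗v))` and `y(u)y(v) = −(y⊗y)(R(u⊗v))`. -/
def BRel (R : E ⊗[ℝ] E →ₗ[ℝ] E ⊗[ℝ] E) :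
    TensorAlgebra ℝ (E × E) → TensorAlgebra ℝ (E × E) → Prop :=
  fun p q => ∃ u v : E,
    (p = ι ℝ (LinearMap.inl ℝ E E u) * ι ℝ (LinearMap.inl ℝ E E v) ∧
      q = pairMul E (LinearMap.inl ℝ E E) (LinearMap.inl ℝ E E) (R (u ⊗ₜ[ℝ] v))) ∨
    (p = ι ℝ (LinearMap.inl ℝ E E u) * ι ℝ (LinearMap.inr ℝ E E v) ∧
      q = pairMul E (LinearMap.inr ℝ E E) (LinearMap.inl ℝ E E) (R (u ⊗ₜ[ℝ] v))) ∨
    (p = ι ℝ (LinearMap.inr ℝ E E u) * ι ℝ (LinearMap.inl ℝ E E v) ∧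
      q = pairMul E (LinearMap.inl ℝ E E) (LinearMap.inr ℝ E E) (R (u ⊗ₜ[ℝ] v))) ∨
    (p = ι ℝ (LinearMap.inr ℝ E E u) * ι ℝ (LinearMap.inr ℝ E E v) ∧
      q = - pairMul E (LinearMap.inr ℝ E E) (LinearMap.inr ℝ E E) (R (u ⊗ₜ[ℝ] v)))

/-- The image of `(a⊗b)(t)` under an algebra map lies in the product of the images of `a`
and `b`. -/
theorem map_pairMul_mem_mul {B : Type*} [Ring B] [Algebra ℝ B]
    (f : TensorAlgebra ℝ (E × E) →ₐ[ℝ] B) (a b : E →ₗ[ℝ] E × E) (t : E ⊗[ℝ] E) :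
    f (pairMul E a b t) ∈
      LinearMap.range (f.toLinearMap ∘ₗ ι ℝ ∘ₗ a) *
        LinearMap.range (f.toLinearMap ∘ₗ ι ℝ ∘ₗ b) := by
  induction t with
  | zero => simp
  | tmul u v =>
    have h : f (pairMul E a b (u ⊗ₜ[ℝ] v)) = f (ι ℝ (a u)) * f (ι ℝ (b v)) := by
      simp [pairMul]
    rw [h]
    exact Submodule.mul_mem_mul ⟨u, rfl⟩ ⟨v, rfl⟩
  | add s t hs ht =>
    rw [map_add, map_add]
    exact Submodule.add_mem _ hs ht

/-- In the quadratic algebra `B` defined by a linear involution `R` of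
`E ⊗ E`, the submodules `X` and `Y` (the images of `x(E)` and `y(E)`) satisfy `X*Y = Y*X`. -/
theorem submodule_X_mul_Y_comm
    [FiniteDimensional ℝ E]
    (R : E ⊗[ℝ] E →ₗ[ℝ] E ⊗[ℝ] E) (hR : R ∘ₗ R = LinearMap.id)
    (X Y : Submodule ℝ (RingQuot (BRel E R)))
    (hX : X = LinearMap.range ((RingQuot.mkAlgHom ℝ (BRel E R)).toLinearMap ∘ₗ
      ι ℝ ∘ₗ LinearMap.inl ℝ E E))
    (hY : Y = LinearMap.range ((RingQuot.mkAlgHom ℝ (BRel E R)).toLinearMap ∘ₗ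
      ι ℝ ∘ₗ LinearMap.inr ℝ E E)) :
    X * Y = Y * X := by
  subst hX hY
  apply le_antisymm
  · rw [Submodule.mul_le]
    rintro _ ⟨u, rfl⟩ _ ⟨v, rfl⟩
    have h := RingQuot.mkAlgHom_rel ℝ
      (show BRel E R _ _ from ⟨u, v, Or.inr (Or.inl ⟨rfl, rfl⟩)⟩)
    rw [map_mul] at h
    exact h ▸ map_pairMul_mem_mul E _ _ _ _
  · rw [Submodule.mul_le]
    rintro _ ⟨u, rfl⟩ _ ⟨v, rfl⟩
    have h := RingQuot.mkAlgHom_rel ℝ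
      (show BRel E R _ _ from ⟨u, v, Or.inr (Or.inr (Or.inl ⟨rfl, rfl⟩))⟩)
    rw [map_mul] at h
    exact h ▸ map_pairMul_mem_mul E _ _ _ _
end
end

section
/- In the quadratic algebra B defined by a linear involution R of E⊗E, one has X^r * Y^s = Y^s * X^r for all natural numbers r, s (equality of products of ℝ-submodules of B). (This is the paper's Lemma asserting A^{(r,s)} = A^{(r,0)}A^{(0,s)} = A^{(0,s)}A^{(r,0)}.) -/
open scoped TensorProduct
open TensorAlgebra

noncomputable section

variable (E : Type*) [AddCommGroup E] [Module ℝ E]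

/-- The image of `pairMul E a b t` under an algebra map lies in the product of the images of the
two inclusions. -/
lemma map_pairMul_mem {B : Type*} [Semiring B] [Algebra ℝ B]
    (f : TensorAlgebra ℝ (E × E) →ₐ[ℝ] B) (a b : E →ₗ[ℝ] E × E) (t : E ⊗[ℝ] E) :
    f (pairMul E a b t) ∈
      LinearMap.range (f.toLinearMap ∘ₗ ι ℝ ∘ₗ a) *
        LinearMap.range (f.toLinearMap ∘ₗ ι ℝ ∘ₗ b) := by
  induction t using TensorProduct.induction_on with
  | zero => simp
  | tmul u v =>
    simpa [pairMul] using
      Submodule.mul_mem_mul (LinearMap.mem_range_self (f.toLinearMap ∘ₗ ι ℝ ∘ₗ a) u)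
        (LinearMap.mem_range_self (f.toLinearMap ∘ₗ ι ℝ ∘ₗ b) v)
  | add s t hs ht => simpa only [map_add] using add_mem hs ht

/-- In the quadratic algebra `B` defined by a linear involution `R` of
`E ⊗ E`, one has `X^r * Y^s = Y^s * X^r` for all `r, s : ℕ` (the paper's Lemma
`A^{(r,s)} = A^{(r,0)}A^{(0,s)} = A^{(0,s)}A^{(r,0)}`). -/
theorem submodule_Xpow_mul_Ypow_comm
    [FiniteDimensional ℝ E]
    (R : E ⊗[ℝ] E →ₗ[ℝ] E ⊗[ℝ] E) (hR : R ∘ₗ R = LinearMap.id)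
    (X Y : Submodule ℝ (RingQuot (BRel E R)))
    (hX : X = LinearMap.range ((RingQuot.mkAlgHom ℝ (BRel E R)).toLinearMap ∘ₗ
      ι ℝ ∘ₗ LinearMap.inl ℝ E E))
    (hY : Y = LinearMap.range ((RingQuot.mkAlgHom ℝ (BRel E R)).toLinearMap ∘ₗ
      ι ℝ ∘ₗ LinearMap.inr ℝ E E)) :
    ∀ r s : ℕ, X ^ r * Y ^ s = Y ^ s * X ^ r := by
  subst hX hY
  intro r s
  refine Commute.pow_pow (le_antisymm ?_ ?_) r s
  all_goals
    rw [Submodule.mul_le]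
    rintro _ ⟨u, rfl⟩ _ ⟨v, rfl⟩
    simp only [LinearMap.comp_apply, AlgHom.toLinearMap_apply]
    rw [← map_mul]
  · rw [RingQuot.mkAlgHom_rel ℝ (show BRel E R _ _ from ⟨u, v, .inr (.inl ⟨rfl, rfl⟩)⟩)]
    exact map_pairMul_mem E _ _ _ _
  · rw [RingQuot.mkAlgHom_rel ℝ (show BRel E R _ _ from ⟨u, v, .inr (.inr (.inl ⟨rfl, rfl⟩))⟩)]
    exact map_pairMul_mem E _ _ _ _
end
end

section
/- Let E be a finite-dimensional real vector space, 𝓡 ⊆ E⊗E a linear subspace, 𝒜 = T(E)/(𝓡) the quadratic algebra with quotient map π : T(E) → 𝒜. Let ε : 𝒜 → ℝ be the unique algebra homomorphism with ε(π(v)) = 0 for all v ∈ E, let μ : 𝒜⊗E → 𝒜 be the linear map a⊗v ↦ a·π(v), and let ν : 𝒜⊗𝓡 → 𝒜⊗E be the linear map determined by a⊗(u⊗v) ↦ (a·π(u))⊗v. Then the sequence 𝒜⊗𝓡 → 𝒜⊗E → 𝒜 → ℝ → 0 is exact: ε is surjective, the range of μ equals the kernel of ε, and the kernel of μ equals the range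 of ν. -/
open scoped TensorProduct
open TensorAlgebra

noncomputable section

variable (E : Type*) [AddCommGroup E] [Module ℝ E]

/-- The linear map `E ⊗ E → T(E)`, `u ⊗ v ↦ ι u * ι v`, embedding quadratic relations
into the tensor algebra. -/
def embQuad : E ⊗[ℝ] E →ₗ[ℝ] TensorAlgebra ℝ E :=
  LinearMap.mul' ℝ (TensorAlgebra ℝ E) ∘ₗ TensorProduct.map (ι ℝ) (ι ℝ)

/-- The relation on `T(E)` identifying the elements of `𝓡 ⊆ E ⊗ E` with `0`; the
corresponding `RingQuot` is the quadratic algebra `𝒜 = T(E)/(𝓡)`. -/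
def QRel (𝓡 : Submodule ℝ (E ⊗[ℝ] E)) :
    TensorAlgebra ℝ E → TensorAlgebra ℝ E → Prop :=
  fun a b => b = 0 ∧ ∃ r ∈ 𝓡, a = embQuad E r

/-- The quadratic algebra `𝒜 = T(E)/(𝓡)`. -/
abbrev QuadAlg (𝓡 : Submodule ℝ (E ⊗[ℝ] E)) : Type _ := RingQuot (QRel E 𝓡)

/-- The quotient map `π : T(E) → 𝒜`. -/
def quadProj (𝓡 : Submodule ℝ (E ⊗[ℝ] E)) : TensorAlgebra ℝ E →ₐ[ℝ] QuadAlg E 𝓡 :=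
  RingQuot.mkAlgHom ℝ (QRel E 𝓡)

@[simp]
lemma embQuad_tmul (u v : E) : embQuad E (u ⊗ₜ[ℝ] v) = ι ℝ u * ι ℝ v := by
  simp [embQuad]

section

variable {E} {𝓡 : Submodule ℝ (E ⊗[ℝ] E)}

lemma quadProj_surjective : Function.Surjective (quadProj E 𝓡) :=
  RingQuot.mkAlgHom_surjective ℝ (QRel E 𝓡)

lemma quadProj_embQuad_of_mem {r : E ⊗[ℝ] E} (hr : r ∈ 𝓡) : quadProj E 𝓡 (embQuad E r) = 0 := by
  have h : QRel E 𝓡 (embQuad E r) 0 := ⟨rfl, r, hr, rfl⟩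
  simpa [quadProj] using RingQuot.mkAlgHom_rel ℝ h

lemma mul_mem_range_of_apply_tmul {μ : QuadAlg E 𝓡 ⊗[ℝ] E →ₗ[ℝ] QuadAlg E 𝓡}
    (hμ : ∀ (a : QuadAlg E 𝓡) (v : E), μ (a ⊗ₜ[ℝ] v) = a * quadProj E 𝓡 (ι ℝ v))
    (a : QuadAlg E 𝓡) {b : QuadAlg E 𝓡} (hb : b ∈ LinearMap.range μ) :
    a * b ∈ LinearMap.range μ := by
  obtain ⟨y, rfl⟩ := hb
  refine ⟨(LinearMap.mulLeft ℝ a).rTensor E y, ?_⟩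
  induction y with
  | zero => simp
  | tmul c v => simp [hμ, mul_assoc]
  | add y z hy hz => simp only [map_add, hy, hz, mul_add]

/-- Modulo right multiples of generators, an element equals its augmentation. -/
lemma exists_mem_range_eq_algebraMap_add {ε : QuadAlg E 𝓡 →ₐ[ℝ] ℝ}
    (hε : ∀ v : E, ε (quadProj E 𝓡 (ι ℝ v)) = 0)
    {μ : QuadAlg E 𝓡 ⊗[ℝ] E →ₗ[ℝ] QuadAlg E 𝓡}
    (hμ : ∀ (a : QuadAlg E 𝓡) (v : E), μ (a ⊗ₜ[ℝ] v) = a * quadProj E 𝓡 (ι ℝ v))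
    (a : QuadAlg E 𝓡) : ∃ b ∈ LinearMap.range μ, a = algebraMap ℝ _ (ε a) + b := by
  obtain ⟨t, rfl⟩ := quadProj_surjective a
  induction t using TensorAlgebra.induction with
  | algebraMap r => exact ⟨0, zero_mem _, by simp⟩
  | ι v => exact ⟨_, ⟨1 ⊗ₜ v, rfl⟩, by simp [hμ, hε]⟩
  | mul s t hs ht =>
    obtain ⟨b, hb, hs⟩ := hs
    obtain ⟨c, hc, ht⟩ := ht
    refine ⟨ε (quadProj E 𝓡 t) • b + quadProj E 𝓡 s * c,
      add_mem (Submodule.smul_mem _ _ hb) (mul_mem_range_of_apply_tmul hμ _ hc), ?_⟩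
    calc quadProj E 𝓡 (s * t)
        = quadProj E 𝓡 s * (algebraMap ℝ _ (ε (quadProj E 𝓡 t)) + c) := by rw [map_mul, ← ht]
      _ = ε (quadProj E 𝓡 t) • quadProj E 𝓡 s + quadProj E 𝓡 s * c := by
        rw [mul_add, ← Algebra.commutes, ← Algebra.smul_def]
      _ = ε (quadProj E 𝓡 t) • (algebraMap ℝ _ (ε (quadProj E 𝓡 s)) + b)
            + quadProj E 𝓡 s * c := by rw [← hs]
      _ = _ := by
        rw [smul_add, Algebra.smul_def, ← map_mul, mul_comm, ← map_mul, ← map_mul, add_assoc]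
  | add s t hs ht =>
    obtain ⟨b, hb, hs⟩ := hs
    obtain ⟨c, hc, ht⟩ := ht
    refine ⟨b + c, add_mem hb hc, ?_⟩
    rw [map_add, map_add, map_add, add_add_add_comm, ← hs, ← ht]

variable {Q : Type*} [AddCommMonoid Q] [Module ℝ Q]

/-- Right multiplication by `v` on `𝒜`, recording the image of `a ⊗ v` under `q`:
`(a, x) ↦ (a * π v, q (a ⊗ v))`. -/
def foxStep (q : QuadAlg E 𝓡 ⊗[ℝ] E →ₗ[ℝ] Q) :
    E →ₗ[ℝ] (Module.End ℝ (QuadAlg E 𝓡 × Q))ᵐᵒᵖ :=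
  (MulOpposite.opLinearEquiv ℝ).toLinearMap ∘ₗ
    LinearMap.mk₂ ℝ
      (fun v x => (x.1 * quadProj E 𝓡 (ι ℝ v), q (x.1 ⊗ₜ[ℝ] v)))
      (fun v w x => by simp [mul_add, TensorProduct.tmul_add])
      (fun c v x => by simp)
      (fun v x y => by simp [add_mul, TensorProduct.add_tmul])
      (fun c v x => by simp [← TensorProduct.smul_tmul'])

@[simp]
lemma unop_foxStep_apply (q : QuadAlg E 𝓡 ⊗[ℝ] E →ₗ[ℝ] Q) (v : E)
    (x : QuadAlg E 𝓡 × Q) :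
    (foxStep q v).unop x = (x.1 * quadProj E 𝓡 (ι ℝ v), q (x.1 ⊗ₜ[ℝ] v)) := rfl

lemma unop_lift_foxStep_embQuad (q : QuadAlg E 𝓡 ⊗[ℝ] E →ₗ[ℝ] Q)
    {ν' : QuadAlg E 𝓡 ⊗[ℝ] (E ⊗[ℝ] E) →ₗ[ℝ] QuadAlg E 𝓡 ⊗[ℝ] E}
    (hν' : ∀ (a : QuadAlg E 𝓡) (u v : E),
      ν' (a ⊗ₜ[ℝ] (u ⊗ₜ[ℝ] v)) = (a * quadProj E 𝓡 (ι ℝ u)) ⊗ₜ[ℝ] v)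
    (r : E ⊗[ℝ] E) (x : QuadAlg E 𝓡 × Q) :
    (TensorAlgebra.lift ℝ (foxStep q) (embQuad E r)).unop x =
      (x.1 * quadProj E 𝓡 (embQuad E r), q (ν' (x.1 ⊗ₜ[ℝ] r))) := by
  induction r with
  | zero => simp [Prod.zero_eq_mk]
  | tmul u v => simp [hν', mul_assoc]
  | add r s hr hs =>
    simp only [map_add, MulOpposite.unop_add, LinearMap.add_apply, hr, hs, mul_add,
      TensorProduct.tmul_add, Prod.mk_add_mk]

lemma fst_unop_lift_foxStep (q : QuadAlg E 𝓡 ⊗[ℝ] E →ₗ[ℝ] Q) (t : TensorAlgebra ℝ E)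
    (x : QuadAlg E 𝓡 × Q) :
    ((TensorAlgebra.lift ℝ (foxStep q) t).unop x).1 = x.1 * quadProj E 𝓡 t := by
  induction t using TensorAlgebra.induction generalizing x with
  | algebraMap r => simp [Algebra.algebraMap_eq_smul_one]
  | ι v => simp
  | mul s t hs ht => simp [hs, ht, mul_assoc]
  | add s t hs ht => simp [hs, ht, mul_add]

/-- A linear map `δ` on `𝒜` with `δ (a * π v) = q (a ⊗ v)` exists as soon as `q` vanishes
on the image of `𝒜 ⊗ 𝓡`. -/
lemma exists_foxDerivative (q : QuadAlg E 𝓡 ⊗[ℝ] E →ₗ[ℝ] Q)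
    {ν' : QuadAlg E 𝓡 ⊗[ℝ] (E ⊗[ℝ] E) →ₗ[ℝ] QuadAlg E 𝓡 ⊗[ℝ] E}
    (hν' : ∀ (a : QuadAlg E 𝓡) (u v : E),
      ν' (a ⊗ₜ[ℝ] (u ⊗ₜ[ℝ] v)) = (a * quadProj E 𝓡 (ι ℝ u)) ⊗ₜ[ℝ] v)
    (hq : ∀ (a : QuadAlg E 𝓡), ∀ r ∈ 𝓡, q (ν' (a ⊗ₜ[ℝ] r)) = 0) :
    ∃ δ : QuadAlg E 𝓡 →ₗ[ℝ] Q,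
      ∀ a v, δ (a * quadProj E 𝓡 (ι ℝ v)) = q (a ⊗ₜ[ℝ] v) := by
  have hrel : ∀ ⦃s t⦄, QRel E 𝓡 s t →
      TensorAlgebra.lift ℝ (foxStep q) s = TensorAlgebra.lift ℝ (foxStep q) t := by
    rintro _ _ ⟨rfl, r, hr, rfl⟩
    refine MulOpposite.unop_injective (LinearMap.ext fun x => ?_)
    rw [unop_lift_foxStep_embQuad q hν', quadProj_embQuad_of_mem hr, hq x.1 r hr]
    simp
  let Φ := RingQuot.liftAlgHom ℝ ⟨TensorAlgebra.lift ℝ (foxStep q), hrel⟩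
  have hΦ (t) : Φ (quadProj E 𝓡 t) = TensorAlgebra.lift ℝ (foxStep q) t :=
    RingQuot.liftAlgHom_mkAlgHom_apply ℝ _ hrel t
  refine ⟨LinearMap.snd ℝ _ _ ∘ₗ LinearMap.applyₗ (1, 0) ∘ₗ
    (MulOpposite.opLinearEquiv ℝ).symm.toLinearMap ∘ₗ Φ.toLinearMap, fun a v => ?_⟩
  obtain ⟨t, rfl⟩ := quadProj_surjective a
  simp [hΦ, fst_unop_lift_foxStep]

end

/-- For the quadratic algebra `𝒜 = T(E)/(𝓡)` with quotient map `π`,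
augmentation `ε : 𝒜 → ℝ` (with `ε(π v) = 0` for `v ∈ E`), `μ : 𝒜⊗E → 𝒜`,
`a⊗v ↦ a·π(v)`, and `ν : 𝒜⊗𝓡 → 𝒜⊗E` induced by `a⊗(u⊗v) ↦ (a·π(u))⊗v`, the sequence
`𝒜⊗𝓡 → 𝒜⊗E → 𝒜 → ℝ → 0` is exact. -/
theorem quadratic_algebra_presentation_exact
    [FiniteDimensional ℝ E] (𝓡 : Submodule ℝ (E ⊗[ℝ] E))
    (ε : QuadAlg E 𝓡 →ₐ[ℝ] ℝ) (hε : ∀ v : E, ε (quadProj E 𝓡 (ι ℝ v)) = 0)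
    (μ : QuadAlg E 𝓡 ⊗[ℝ] E →ₗ[ℝ] QuadAlg E 𝓡)
    (hμ : ∀ (a : QuadAlg E 𝓡) (v : E), μ (a ⊗ₜ[ℝ] v) = a * quadProj E 𝓡 (ι ℝ v))
    (ν' : QuadAlg E 𝓡 ⊗[ℝ] (E ⊗[ℝ] E) →ₗ[ℝ] QuadAlg E 𝓡 ⊗[ℝ] E)
    (hν' : ∀ (a : QuadAlg E 𝓡) (u v : E),
      ν' (a ⊗ₜ[ℝ] (u ⊗ₜ[ℝ] v)) = (a * quadProj E 𝓡 (ι ℝ u)) ⊗ₜ[ℝ] v) :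
    Function.Surjective ε ∧
    LinearMap.range μ = LinearMap.ker ε.toLinearMap ∧
    LinearMap.ker μ = LinearMap.range (ν' ∘ₗ LinearMap.lTensor (QuadAlg E 𝓡) 𝓡.subtype) := by
  refine ⟨fun r => ⟨algebraMap ℝ _ r, by simp⟩, le_antisymm ?_ fun a ha => ?_,
    le_antisymm (fun y hy => ?_) ?_⟩
  · rw [LinearMap.range_le_ker_iff]
    exact TensorProduct.ext' fun a v => by simp [hμ, hε]
  · have ha' : ε a = 0 := ha
    obtain ⟨b, hb, hab⟩ := exists_mem_range_eq_algebraMap_add hε hμ a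
    rw [hab, ha', map_zero, zero_add]
    exact hb
  · let _ : AddCommGroup (QuadAlg E 𝓡 ⊗[ℝ] E) := Module.addCommMonoidToAddCommGroup ℝ
    set N : Submodule ℝ (QuadAlg E 𝓡 ⊗[ℝ] E) :=
      LinearMap.range (ν' ∘ₗ LinearMap.lTensor (QuadAlg E 𝓡) 𝓡.subtype)
    obtain ⟨δ, hδ⟩ := exists_foxDerivative N.mkQ hν' fun a r hr =>
      (Submodule.Quotient.mk_eq_zero N).2 ⟨a ⊗ₜ ⟨r, hr⟩, by simp⟩
    have h : δ ∘ₗ μ = N.mkQ := TensorProduct.ext' fun a v => by simp [hμ, hδ]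
    rw [← N.ker_mkQ, ← h]
    exact LinearMap.ker_le_ker_comp μ δ hy
  · rw [LinearMap.range_le_ker_iff]
    have h : ∀ (a : QuadAlg E 𝓡) (r : E ⊗[ℝ] E),
        μ (ν' (a ⊗ₜ r)) = a * quadProj E 𝓡 (embQuad E r) := fun a r => by
      induction r with
      | zero => simp
      | tmul u v => simp [hν', hμ, mul_assoc]
      | add r s hr hs => simp only [TensorProduct.tmul_add, map_add, hr, hs, mul_add]
    exact TensorProduct.ext' fun a r => by simp [h, quadProj_embQuad_of_mem r.2]
end
end

section
/- Let n ∈ ℕ and E = ℝⁿ (the space of functions Fin n → ℝ), and let R : E⊗E → E⊗E be the flip map R(u⊗v) = v⊗u. Then the algebra B — the quotient of T(E⊕E) by the two-sided ideal generated by the elements x(u)⊗x(v) − x(v)⊗x(u), x(u)⊗y(v) − y(v)⊗x(u), y(u)⊗x(v) − x(v)⊗y(u), and y(u)⊗y(v) + y(v)⊗y(u) for u,v ∈ E, where x, y : E → E⊕E are the two canonical inclusions — is isomorphic as an ℝ-algebra to the tensor product of algebras (MvPolynomial (Fin n) ℝ) ⊗_ℝ Λ(E), via an isomorphism sending the class of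 x(e_λ) to X_λ⊗1 and the class of y(e_λ) to 1⊗e_λ, where Λ(E) is the exterior algebra of E. (This identifies the algebra Ω(𝒜) of the paper in the classical case with the algebra of exterior polynomial differential forms S(ℝⁿ)⊗Λ(ℝⁿ) on ℝⁿ.) -/
open TensorAlgebra

/-- The relations of the paper's algebra `Ω(𝒜)` in the classical case (`R` the flip):
with `x, y : E → E ⊕ E` the two canonical inclusions, the `x`'s commute among themselves
and with the `y`'s, and the `y`'s anticommute among themselves. -/
def ClassicalRel (n : ℕ) :
    TensorAlgebra ℝ ((Fin n → ℝ) × (Fin n → ℝ)) →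
      TensorAlgebra ℝ ((Fin n → ℝ) × (Fin n → ℝ)) → Prop :=
  fun a b => ∃ u v : Fin n → ℝ,
    (a = ι ℝ (LinearMap.inl ℝ _ _ u) * ι ℝ (LinearMap.inl ℝ _ _ v) ∧
      b = ι ℝ (LinearMap.inl ℝ _ _ v) * ι ℝ (LinearMap.inl ℝ _ _ u)) ∨
    (a = ι ℝ (LinearMap.inl ℝ _ _ u) * ι ℝ (LinearMap.inr ℝ _ _ v) ∧
      b = ι ℝ (LinearMap.inr ℝ _ _ v) * ι ℝ (LinearMap.inl ℝ _ _ u)) ∨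
    (a = ι ℝ (LinearMap.inr ℝ _ _ u) * ι ℝ (LinearMap.inl ℝ _ _ v) ∧
      b = ι ℝ (LinearMap.inl ℝ _ _ v) * ι ℝ (LinearMap.inr ℝ _ _ u)) ∨
    (a = ι ℝ (LinearMap.inr ℝ _ _ u) * ι ℝ (LinearMap.inr ℝ _ _ v) ∧
      b = - (ι ℝ (LinearMap.inr ℝ _ _ v) * ι ℝ (LinearMap.inr ℝ _ _ u)))

open scoped TensorProduct

open scoped IsMulCommutative in
/-- A pairwise commuting family in a possibly noncommutative algebra extends to an algebra
homomorphism from the polynomial algebra. -/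
theorem MvPolynomial.exists_algHom_of_commute {R σ A : Type*} [CommRing R] [Ring A] [Algebra R A]
    (f : σ → A) (hf : ∀ i j, Commute (f i) (f j)) :
    ∃ g : MvPolynomial σ R →ₐ[R] A, ∀ i, g (MvPolynomial.X i) = f i := by
  have : IsMulCommutative (Algebra.adjoin R (Set.range f)) :=
    Algebra.isMulCommutative_adjoin R (by rintro _ ⟨i, rfl⟩ _ ⟨j, rfl⟩; exact hf i j)
  let f' : σ → Algebra.adjoin R (Set.range f) :=
    fun i => ⟨f i, Algebra.subset_adjoin (Set.mem_range_self i)⟩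
  refine ⟨(Algebra.adjoin R (Set.range f)).val.comp (MvPolynomial.aeval f'), fun i => ?_⟩
  rw [AlgHom.comp_apply, MvPolynomial.aeval_X]
  rfl

/-- If the generators of a polynomial algebra and of an exterior algebra have commuting images,
then so do all their elements. -/
theorem commute_algHom_mvPolynomial_exteriorAlgebra {R σ M A : Type*} [CommRing R]
    [AddCommGroup M] [Module R M] [Ring A] [Algebra R A]
    (f : MvPolynomial σ R →ₐ[R] A) (g : ExteriorAlgebra R M →ₐ[R] A)
    (h : ∀ i m, Commute (f (MvPolynomial.X i)) (g (ExteriorAlgebra.ι R m)))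
    (p : MvPolynomial σ R) (w : ExteriorAlgebra R M) : Commute (f p) (g w) := by
  induction p using MvPolynomial.induction_on with
  | C r =>
    rw [← MvPolynomial.algebraMap_eq, AlgHom.commutes]
    exact Algebra.commutes r _
  | add p q hp hq => rw [map_add]; exact hp.add_left hq
  | mul_X p i hp =>
    rw [map_mul]
    refine hp.mul_left ?_
    clear hp
    induction w using ExteriorAlgebra.induction with
    | algebraMap r => rw [AlgHom.commutes]; exact (Algebra.commutes r _).symm
    | ι m => exact h i m
    | mul a b ha hb => rw [map_mul]; exact ha.mul_right hb
    | add a b ha hb => rw [map_add]; exact ha.add_right hb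

namespace ClassicalRel

variable {n : ℕ}

/-- The class of `x(u)` in the quotient of `T(E ⊕ E)` by the classical relations. -/
noncomputable def x (n : ℕ) : (Fin n → ℝ) →ₗ[ℝ] RingQuot (ClassicalRel n) :=
  (RingQuot.mkAlgHom ℝ (ClassicalRel n)).toLinearMap ∘ₗ ι ℝ ∘ₗ LinearMap.inl ℝ _ _

/-- The class of `y(u)` in the quotient of `T(E ⊕ E)` by the classical relations. -/
noncomputable def y (n : ℕ) : (Fin n → ℝ) →ₗ[ℝ] RingQuot (ClassicalRel n) :=
  (RingQuot.mkAlgHom ℝ (ClassicalRel n)).toLinearMap ∘ₗ ι ℝ ∘ₗ LinearMap.inr ℝ _ _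

theorem commute_x_x (u v : Fin n → ℝ) : Commute (x n u) (x n v) := by
  have h := RingQuot.mkAlgHom_rel ℝ (s := ClassicalRel n) ⟨u, v, Or.inl ⟨rfl, rfl⟩⟩
  rwa [map_mul, map_mul] at h

theorem commute_x_y (u v : Fin n → ℝ) : Commute (x n u) (y n v) := by
  have h := RingQuot.mkAlgHom_rel ℝ (s := ClassicalRel n) ⟨u, v, Or.inr (Or.inl ⟨rfl, rfl⟩)⟩
  rwa [map_mul, map_mul] at h

theorem y_mul_self (u : Fin n → ℝ) : y n u * y n u = 0 := by
  have h := RingQuot.mkAlgHom_rel ℝ (s := ClassicalRel n)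
    ⟨u, u, Or.inr (Or.inr (Or.inr ⟨rfl, rfl⟩))⟩
  rw [map_neg, map_mul] at h
  have h2 : (2 : ℝ) • (y n u * y n u) = 0 := by
    rw [two_smul]
    exact eq_neg_iff_add_eq_zero.mp h
  exact (smul_eq_zero.mp h2).resolve_left two_ne_zero

theorem algHom_ext {A : Type*} [Ring A] [Algebra ℝ A] {f g : RingQuot (ClassicalRel n) →ₐ[ℝ] A}
    (hx : ∀ i, f (x n (Pi.single i 1)) = g (x n (Pi.single i 1)))
    (hy : ∀ i, f (y n (Pi.single i 1)) = g (y n (Pi.single i 1))) : f = g := by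
  apply RingQuot.ringQuot_ext'
  apply TensorAlgebra.hom_ext
  apply LinearMap.prod_ext
  · refine (Pi.basisFun ℝ (Fin n)).ext fun i => ?_
    rw [Pi.basisFun_apply]
    exact hx i
  · refine (Pi.basisFun ℝ (Fin n)).ext fun i => ?_
    rw [Pi.basisFun_apply]
    exact hy i

/-- The linear map sending `e_i` to the variable `X_i`. -/
noncomputable def linearForm (n : ℕ) : (Fin n → ℝ) →ₗ[ℝ] MvPolynomial (Fin n) ℝ :=
  (Pi.basisFun ℝ (Fin n)).constr ℝ MvPolynomial.X

theorem linearForm_single (i : Fin n) : linearForm n (Pi.single i 1) = MvPolynomial.X i := by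
  rw [← Pi.basisFun_apply, linearForm, Module.Basis.constr_basis]

/-- The algebra homomorphism from `T(E ⊕ E)` to polynomial differential forms. -/
noncomputable def tensorToForms (n : ℕ) :
    TensorAlgebra ℝ ((Fin n → ℝ) × (Fin n → ℝ)) →ₐ[ℝ]
      MvPolynomial (Fin n) ℝ ⊗[ℝ] ExteriorAlgebra ℝ (Fin n → ℝ) :=
  TensorAlgebra.lift ℝ (LinearMap.coprod
    (Algebra.TensorProduct.includeLeft.toLinearMap ∘ₗ linearForm n)
    (Algebra.TensorProduct.includeRight.toLinearMap ∘ₗ ExteriorAlgebra.ι ℝ))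

theorem tensorToForms_inl (u : Fin n → ℝ) :
    tensorToForms n (ι ℝ (LinearMap.inl ℝ _ _ u)) = linearForm n u ⊗ₜ 1 := by
  simp [tensorToForms]

theorem tensorToForms_inr (u : Fin n → ℝ) :
    tensorToForms n (ι ℝ (LinearMap.inr ℝ _ _ u)) = 1 ⊗ₜ ExteriorAlgebra.ι ℝ u := by
  simp [tensorToForms]

theorem tensorToForms_rel ⦃a b : TensorAlgebra ℝ ((Fin n → ℝ) × (Fin n → ℝ))⦄
    (h : ClassicalRel n a b) : tensorToForms n a = tensorToForms n b := by
  obtain ⟨u, v, ⟨rfl, rfl⟩ | ⟨rfl, rfl⟩ | ⟨rfl, rfl⟩ | ⟨rfl, rfl⟩⟩ := h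
  · simp only [map_mul, tensorToForms_inl, Algebra.TensorProduct.tmul_mul_tmul, mul_comm]
  · simp only [map_mul, tensorToForms_inl, tensorToForms_inr,
      Algebra.TensorProduct.tmul_mul_tmul, mul_one, one_mul]
  · simp only [map_mul, tensorToForms_inl, tensorToForms_inr,
      Algebra.TensorProduct.tmul_mul_tmul, mul_one, one_mul]
  · simp only [map_neg, map_mul, tensorToForms_inr, Algebra.TensorProduct.tmul_mul_tmul,
      mul_one, ← TensorProduct.tmul_neg]
    rw [eq_neg_of_add_eq_zero_left (ExteriorAlgebra.ι_add_mul_swap u v)]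

/-- The algebra homomorphism from the quotient algebra to polynomial differential forms. -/
noncomputable def toForms (n : ℕ) :
    RingQuot (ClassicalRel n) →ₐ[ℝ]
      MvPolynomial (Fin n) ℝ ⊗[ℝ] ExteriorAlgebra ℝ (Fin n → ℝ) :=
  RingQuot.liftAlgHom ℝ ⟨tensorToForms n, tensorToForms_rel⟩

theorem toForms_x (i : Fin n) :
    toForms n (x n (Pi.single i 1)) = MvPolynomial.X i ⊗ₜ 1 := by
  rw [← linearForm_single, ← tensorToForms_inl]
  exact RingQuot.liftAlgHom_mkAlgHom_apply ℝ _ _ _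

theorem toForms_y (u : Fin n → ℝ) :
    toForms n (y n u) = 1 ⊗ₜ ExteriorAlgebra.ι ℝ u := by
  rw [← tensorToForms_inr]
  exact RingQuot.liftAlgHom_mkAlgHom_apply ℝ _ _ _

theorem exists_ofForms (n : ℕ) :
    ∃ Ψ : MvPolynomial (Fin n) ℝ ⊗[ℝ] ExteriorAlgebra ℝ (Fin n → ℝ) →ₐ[ℝ]
        RingQuot (ClassicalRel n),
      (∀ i, Ψ (MvPolynomial.X i ⊗ₜ 1) = x n (Pi.single i 1)) ∧
      ∀ u, Ψ (1 ⊗ₜ ExteriorAlgebra.ι ℝ u) = y n u := by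
  obtain ⟨f, hf⟩ := MvPolynomial.exists_algHom_of_commute (R := ℝ)
    (fun i => x n (Pi.single i 1)) (fun i j => commute_x_x _ _)
  let g := ExteriorAlgebra.lift ℝ ⟨y n, y_mul_self⟩
  have hg (u) : g (ExteriorAlgebra.ι ℝ u) = y n u := ExteriorAlgebra.lift_ι_apply ℝ _ _ u
  refine ⟨Algebra.TensorProduct.lift f g
    (commute_algHom_mvPolynomial_exteriorAlgebra f g fun i m => ?_), fun i => ?_, fun u => ?_⟩
  · rw [hf, hg]
    exact commute_x_y _ _
  · rw [Algebra.TensorProduct.lift_tmul, map_one, mul_one, hf]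
  · rw [Algebra.TensorProduct.lift_tmul, map_one, one_mul, hg]

end ClassicalRel

open scoped TensorProduct in
/-- For `E = ℝⁿ` and `R` the flip of `E ⊗ E`, the algebra `B`
(the quotient of `T(E ⊕ E)` by the relations: `x`'s commute, `x`'s commute with `y`'s,
`y`'s anticommute) is isomorphic as an `ℝ`-algebra to
`ℝ[X₁,…,Xₙ] ⊗ Λ(ℝⁿ)`, sending the class of `x(e_λ)` to `X_λ ⊗ 1` and the class of
`y(e_λ)` to `1 ⊗ e_λ`: the algebra of exterior polynomial differential forms on `ℝⁿ`. -/
theorem classical_bigraded_algebra_iso_polynomial_forms (n : ℕ) :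
    ∃ Φ : RingQuot (ClassicalRel n) ≃ₐ[ℝ]
        (MvPolynomial (Fin n) ℝ ⊗[ℝ] ExteriorAlgebra ℝ (Fin n → ℝ)),
      (∀ lam : Fin n,
        Φ (RingQuot.mkAlgHom ℝ _ (ι ℝ (LinearMap.inl ℝ _ _ (Pi.single lam 1)))) =
          MvPolynomial.X lam ⊗ₜ[ℝ] 1) ∧
      (∀ lam : Fin n,
        Φ (RingQuot.mkAlgHom ℝ _ (ι ℝ (LinearMap.inr ℝ _ _ (Pi.single lam 1)))) =
          1 ⊗ₜ[ℝ] ExteriorAlgebra.ι ℝ (Pi.single lam 1)) := by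
  obtain ⟨Ψ, hx, hy⟩ := ClassicalRel.exists_ofForms n
  refine ⟨AlgEquiv.ofAlgHom (ClassicalRel.toForms n) Ψ ?_ ?_,
    ClassicalRel.toForms_x, fun i => ClassicalRel.toForms_y _⟩
  · ext i
    · simp [hx, ClassicalRel.toForms_x]
    · simp [hy, ClassicalRel.toForms_y]
  · apply ClassicalRel.algHom_ext
    · intro i
      simp [hx, ClassicalRel.toForms_x]
    · intro i
      simp [hy, ClassicalRel.toForms_y]
end
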